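/- arXiv:1305.3464 — 2 statements merged into one kernel-verified Lean document; each statement's English description precedes it below -/
import Mathlib

section
/- Let $k$ be an algebraically closed field, $U$ a $3$-dimensional $k$-vector space, and $V$, $W$ finite-dimensional $k$-vector spaces. Let $\mu : U \times V \to W$ be a bilinear map such that for every nonzero $u \in U$ the induced linear map $\mu(u,\cdot) : V \to W$ is surjective. If $W \neq 0$, then $\dim W \leq \dim V - 2$. -/
open MvPolynomial in
/-- The bilinear forms attached to the coefficients `c`. -/
noncomputable def bilForm {k : Type*} [Field k] {a n b : ℕ} (c : Fin a → Fin n → Fin b → k)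
    (l : Fin n) : MvPolynomial (Fin a ⊕ Fin b) k :=
  ∑ i, ∑ j, C (c i l j) * X (Sum.inl i) * X (Sum.inr j)

open MvPolynomial in
theorem aeval_bilForm {k K : Type*} [Field k] [Field K] [Algebra k K] {a n b : ℕ}
    (c : Fin a → Fin n → Fin b → k) (l : Fin n) (x : Fin a → K) (y : Fin b → K) :
    aeval (Sum.elim x y) (bilForm c l) = ∑ i, ∑ j, algebraMap k K (c i l j) * x i * y j := by
  simp [bilForm]

open MvPolynomial in
/-- Nullstellensatz step. -/
theorem exists_pow_mem_bilForm {k : Type*} [Field k] [IsAlgClosed k] {a n b : ℕ}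
    (c : Fin a → Fin n → Fin b → k)
    (hc : ∀ (x : Fin a → k) (y : Fin b → k),
      (∀ l, ∑ i, ∑ j, c i l j * x i * y j = 0) → x = 0 ∨ y = 0) (i : Fin a) (j : Fin b) :
    ∃ N : ℕ, (X (Sum.inl i) * X (Sum.inr j) : MvPolynomial (Fin a ⊕ Fin b) k) ^ N ∈
      Ideal.span (Set.range (bilForm c)) := by
  change (X (Sum.inl i) * X (Sum.inr j) : MvPolynomial (Fin a ⊕ Fin b) k) ∈
      (Ideal.span (Set.range (bilForm c))).radical
  rw [← vanishingIdeal_zeroLocus_eq_radical (K := k), mem_vanishingIdeal_iff]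
  intro z hz
  obtain ⟨x, y, rfl⟩ : ∃ x y, z = Sum.elim x y :=
    ⟨z ∘ Sum.inl, z ∘ Sum.inr, (Sum.elim_comp_inl_inr z).symm⟩
  have h := hc x y (fun l => by
    have := hz (bilForm c l) (Ideal.subset_span ⟨l, rfl⟩)
    rw [aeval_bilForm] at this
    simpa using this)
  rcases h with rfl | rfl <;> simp

theorem exists_div_mem {K : Type*} [Field K] (O : ValuationSubring K) {a : ℕ} (x : Fin a → K)
    (hx : x ≠ 0) : ∃ i, x i ≠ 0 ∧ ∀ i', x i' / x i ∈ O := by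
  obtain ⟨i1, hi1⟩ := Function.ne_iff.mp hx
  have : Nonempty (Fin a) := ⟨i1⟩
  obtain ⟨i, hi⟩ := Finite.exists_max (fun i => O.valuation (x i))
  have h0 : x i ≠ 0 := by
    intro h
    have := hi i1
    rw [h, map_zero] at this
    exact hi1 (by simpa using this)
  refine ⟨i, h0, fun i' => ?_⟩
  rw [← O.valuation_le_one_iff, map_div₀]
  exact div_le_one_of_le₀ (hi i') zero_le

open MvPolynomial in
/-- Valuation step. -/
theorem mul_mem_valuationSubring {k K : Type*} [Field k] [IsAlgClosed k] [Field K] [Algebra k K]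
    {a n b : ℕ} (c : Fin a → Fin n → Fin b → k)
    (hc : ∀ (x : Fin a → k) (y : Fin b → k),
      (∀ l, ∑ i, ∑ j, c i l j * x i * y j = 0) → x = 0 ∨ y = 0)
    (O : ValuationSubring K) (hk : ∀ r : k, algebraMap k K r ∈ O)
    (x : Fin a → K) (y : Fin b → K)
    (hf : ∀ l, aeval (Sum.elim x y) (bilForm c l) ∈ O) (i : Fin a) (j : Fin b) :
    x i * y j ∈ O := by
  by_cases hx : x = 0
  · simp [hx, O.zero_mem]
  by_cases hy : y = 0
  · simp [hy, O.zero_mem]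
  obtain ⟨i0, hi0, hi⟩ := exists_div_mem O x hx
  obtain ⟨j0, hj0, hj⟩ := exists_div_mem O y hy
  set z : Fin a ⊕ Fin b → K := Sum.elim (fun i => x i / x i0) (fun j => y j / y j0) with hz
  have hzO : ∀ s, z s ∈ O := by
    rintro (s | s)
    · exact hi s
    · exact hj s
  have hpoly : ∀ p : MvPolynomial (Fin a ⊕ Fin b) k, aeval z p ∈ O := by
    intro p
    induction p using MvPolynomial.induction_on with
    | C r => simpa using hk r
    | add p q hp hq => rw [map_add]; exact O.add_mem _ _ hp hq
    | mul_X p s hp => rw [map_mul, aeval_X]; exact O.mul_mem _ _ hp (hzO s)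
  have key : ∀ p ∈ Ideal.span (Set.range (bilForm c)), x i0 * y j0 * aeval z p ∈ O := by
    intro p hp
    induction hp using Submodule.span_induction with
    | mem p hp =>
      obtain ⟨l, rfl⟩ := hp
      convert hf l using 1
      rw [hz, aeval_bilForm, aeval_bilForm, Finset.mul_sum]
      refine Finset.sum_congr rfl fun i _ => ?_
      rw [Finset.mul_sum]
      refine Finset.sum_congr rfl fun j _ => ?_
      field_simp
    | zero => simp [O.zero_mem]
    | add p q _ _ hp hq => rw [map_add, mul_add]; exact O.add_mem _ _ hp hq
    | smul r p _ hp =>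
      rw [smul_eq_mul, map_mul, mul_left_comm]
      exact O.mul_mem _ _ (hpoly r) hp
  obtain ⟨N, hN⟩ := exists_pow_mem_bilForm c hc i0 j0
  have h1 := key _ hN
  have h2 : aeval z ((X (Sum.inl i0) * X (Sum.inr j0) : MvPolynomial (Fin a ⊕ Fin b) k) ^ N) = 1 := by
    simp [hz, div_self hi0, div_self hj0]
  rw [h2, mul_one] at h1
  have h3 : x i * y j = (x i0 * y j0) * ((x i / x i0) * (y j / y j0)) := by
    field_simp
  rw [h3]
  exact O.mul_mem _ _ h1 (O.mul_mem _ _ (hi i) (hj j))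

open MvPolynomial in
theorem isIntegral_mul {k K : Type*} [Field k] [IsAlgClosed k] [Field K] [Algebra k K]
    {a n b : ℕ} (c : Fin a → Fin n → Fin b → k)
    (hc : ∀ (x : Fin a → k) (y : Fin b → k),
      (∀ l, ∑ i, ∑ j, c i l j * x i * y j = 0) → x = 0 ∨ y = 0)
    (x : Fin a → K) (y : Fin b → K) (i : Fin a) (j : Fin b) :
    IsIntegral (Algebra.adjoin k (Set.range fun l => aeval (Sum.elim x y) (bilForm c l)))
      (x i * y j) := by
  set A := Algebra.adjoin k (Set.range fun l => aeval (Sum.elim x y) (bilForm c l)) with hA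
  have h : x i * y j ∈ (integralClosure (Subring.closure (A : Set K)) K).toSubring := by
    rw [← iInf_valuationSubring_superset, Subring.mem_iInf]
    rintro ⟨O, hO⟩
    exact mul_mem_valuationSubring c hc O (fun r => hO (A.algebraMap_mem r)) x y
      (fun l => hO (Algebra.subset_adjoin ⟨l, rfl⟩)) i j
  have h' : IsIntegral (Subring.closure (A : Set K)) (x i * y j) := h
  have e : Subring.closure (A : Set K) = A.toSubring := Subring.closure_eq A.toSubring
  rw [e] at h'
  exact h'

open MvPolynomial in
theorem hopf_coord {k : Type*} [Field k] [IsAlgClosed k]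
    {a n b : ℕ} (c : Fin (a + 1) → Fin n → Fin (b + 1) → k)
    (hc : ∀ (x : Fin (a + 1) → k) (y : Fin (b + 1) → k),
      (∀ l, ∑ i, ∑ j, c i l j * x i * y j = 0) → x = 0 ∨ y = 0) :
    a + 1 + b ≤ n := by
  let P := MvPolynomial (Fin (a + 1) ⊕ Fin b) k
  let K := FractionRing P
  let x : Fin (a + 1) → K := fun i => algebraMap P K (X (Sum.inl i))
  let y : Fin (b + 1) → K := Fin.cons 1 (fun j => algebraMap P K (X (Sum.inr j)))
  let S : Set K := Set.range fun l => aeval (Sum.elim x y) (bilForm c l)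
  have hint : ∀ i j, IsAlgebraic (Algebra.adjoin k S) (x i * y j) := fun i j =>
    (isIntegral_mul c hc x y i j).isAlgebraic
  have hxa : ∀ i, IsAlgebraic (Algebra.adjoin k S) (x i) := fun i => by
    simpa [y] using hint i 0
  have hx0 : x 0 ≠ 0 := by
    simp only [x]
    rw [Ne, IsFractionRing.to_map_eq_zero_iff]
    exact X_ne_zero _
  have hya : ∀ j, IsAlgebraic (Algebra.adjoin k S) (algebraMap P K (X (Sum.inr j))) := fun j => by
    have h := (hxa 0).inv.mul (hint 0 j.succ)
    rw [inv_mul_cancel_left₀ hx0] at h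
    simpa [y] using h
  have hP : ∀ p : P, IsAlgebraic (Algebra.adjoin k S) (algebraMap P K p) := by
    intro p
    induction p using MvPolynomial.induction_on with
    | C r =>
      have : algebraMap P K (C r) = algebraMap (Algebra.adjoin k S) K (algebraMap k _ r) := by
        rw [← IsScalarTower.algebraMap_apply, IsScalarTower.algebraMap_apply k P K]
        rfl
      rw [this]
      exact isAlgebraic_algebraMap _
    | add p q hp hq => rw [map_add]; exact hp.add hq
    | mul_X p s hp =>
      rw [map_mul]
      refine hp.mul ?_
      rcases s with s | s
      · exact hxa s
      · exact hya s
  have : Algebra.IsAlgebraic (Algebra.adjoin k S) K := ⟨fun w => by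
    obtain ⟨p, q, _, rfl⟩ := IsFractionRing.div_surjective (A := P) w
    rw [div_eq_mul_inv]
    exact (hP p).mul (hP q).inv⟩
  have h1 := Algebra.IsAlgebraic.trdeg_le_cardinalMk k S
  have h2 : AlgebraicIndependent k (fun s => algebraMap P K (X s)) :=
    (MvPolynomial.algebraicIndependent_X (Fin (a + 1) ⊕ Fin b) k).map'
      (f := IsScalarTower.toAlgHom k P K) (IsFractionRing.injective P K)
  have h3 := h2.lift_cardinalMk_le_trdeg
  have h4 : Cardinal.mk S ≤ n := by
    have := Cardinal.mk_range_le_lift (f := fun l => aeval (Sum.elim x y) (bilForm c l))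
    simpa using this
  have h5 := h1.trans h4
  rw [← Cardinal.lift_le.{0}] at h5
  have h6 := h3.trans h5
  simp at h6
  exact_mod_cast h6


/-- Let `k` be algebraically closed, `U` a `3`-dimensional `k`-vector space, and `V`, `W`
finite-dimensional `k`-vector spaces. If `μ : U × V → W` is a bilinear map such that
`μ(u, ·) : V → W` is surjective for every nonzero `u`, and `W ≠ 0`, then
`dim W ≤ dim V - 2`. -/
theorem surjective_bilinear_dim_le {k U V W : Type*} [Field k] [IsAlgClosed k]
    [AddCommGroup U] [Module k U] [FiniteDimensional k U]
    [AddCommGroup V] [Module k V] [FiniteDimensional k V]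
    [AddCommGroup W] [Module k W] [FiniteDimensional k W]
    (hU : Module.finrank k U = 3)
    (μ : U →ₗ[k] V →ₗ[k] W)
    (hμ : ∀ u : U, u ≠ 0 → Function.Surjective (μ u))
    (hW : Nontrivial W) :
    Module.finrank k W + 2 ≤ Module.finrank k V := by
  obtain ⟨b, hb⟩ : ∃ b, Module.finrank k W = b + 1 :=
    ⟨Module.finrank k W - 1, by have := Module.finrank_pos (R := k) (M := W); omega⟩
  let bU := Module.finBasisOfFinrankEq k U hU
  let bV := Module.finBasis k V
  let bW := Module.finBasisOfFinrankEq k W hb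
  have := hopf_coord (a := 2) (fun i l j => bW.repr (μ (bU i) (bV l)) j) (by
    intro x y h
    by_contra! hxy
    obtain ⟨hx, hy⟩ := hxy
    let u : U := ∑ i, x i • bU i
    have hu : u ≠ 0 := by
      intro h0
      apply hx
      funext i
      exact Fintype.linearIndependent_iff.mp bU.linearIndependent x h0 i
    let φ : W →ₗ[k] k := bW.constr k y
    have hφ : φ ∘ₗ μ u = 0 := by
      apply bV.ext
      intro l
      have hl := h l
      simp only [φ, u, LinearMap.comp_apply, map_sum, map_smul, LinearMap.sum_apply,
        LinearMap.smul_apply, LinearMap.zero_apply, Module.Basis.constr_apply_fintype]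
      rw [← hl]
      refine Finset.sum_congr rfl fun i _ => ?_
      rw [Finset.smul_sum]
      refine Finset.sum_congr rfl fun j _ => ?_
      simp only [smul_eq_mul, Module.Basis.equivFun_apply]
      ring
    apply hy
    funext j
    obtain ⟨v, hv⟩ := hμ u hu (bW j)
    have h1 := LinearMap.congr_fun hφ v
    rw [LinearMap.comp_apply, hv] at h1
    simpa [φ] using h1)
  omega
end

section
/- Let $k$ be an infinite field, let $P_0, P_1, P_2, P_3 \in \mathbb{P}^3(k)$ be four points spanning $\mathbb{P}^3$ (not contained in any plane), and let $L \subset \mathbb{P}^3$ be a line containing none of the $P_i$. Then the $k$-vector space of homogeneous quadratic forms $q \in k[X_0,X_1,X_2,X_3]_2$ vanishing identically on $L$ and vanishing at each of $P_0, P_1, P_2, P_3$ has dimension exactly $3$. -/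
open MvPolynomial

lemma aux_finrank_quadrics (k : Type*) [Field k] :
    Module.finrank k (homogeneousSubmodule (Fin 4) k 2) = 10 := by
  have e0 : Sym (Fin 4) 2 ≃ {d : Fin 4 →₀ ℕ | d.degree = 2} :=
    (Sym.equivNatSum (Fin 4) 2).trans (Equiv.subtypeEquivRight (by
      intro d
      simp [Finsupp.degree_apply, Finsupp.sum]))
  rw [homogeneousSubmodule_eq_finsupp_supported]
  have e := AddMonoidAlgebra.supportedEquivFinsupp (R := k) (S := k)
    {d : Fin 4 →₀ ℕ | d.degree = 2}
  have : Fintype {d : Fin 4 →₀ ℕ | d.degree = 2} := Fintype.ofEquiv _ e0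
  refine e.finrank_eq.trans ?_
  rw [Module.finrank_finsupp_self, ← Fintype.card_congr e0, Sym.card_sym_eq_choose]
  decide

lemma aux_linear {k : Type*} [Field k] (p : MvPolynomial (Fin 4) k)
    (hp : p ∈ homogeneousSubmodule (Fin 4) k 1) (u v : Fin 4 → k) (s t : k) :
    aeval (s • u + t • v) p = s * aeval u p + t * aeval v p := by
  rw [homogeneousSubmodule_one_eq_span_X] at hp
  induction hp using Submodule.span_induction with
  | mem x h => obtain ⟨i, rfl⟩ := h; simp
  | zero => simp
  | add x y _ _ hx hy => simp only [map_add, hx, hy]; ring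
  | smul a x _ hx => simp only [map_smul, hx, smul_eq_mul]; ring

lemma aux_quadratic {k : Type*} [Field k] (q : MvPolynomial (Fin 4) k)
    (hq : q ∈ homogeneousSubmodule (Fin 4) k 2) (u v : Fin 4 → k) (s t : k) :
    aeval (s • u + t • v) q = s ^ 2 * aeval u q + t ^ 2 * aeval v q
      + s * t * (aeval (u + v) q - aeval u q - aeval v q) := by
  rw [← homogeneousSubmodule_one_pow, pow_two] at hq
  induction hq using Submodule.mul_induction_on' with
  | mem_mul_mem x hx y hy =>
    have h1 := aux_linear x hx u v 1 1
    have h2 := aux_linear y hy u v 1 1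
    simp only [one_smul, one_mul] at h1 h2
    simp only [map_mul, aux_linear x hx, aux_linear y hy, h1, h2]
    ring
  | add x _ y _ hx hy => simp only [map_add, hx, hy]; ring

/-- Values at the four points, and coefficients of the restriction to the line. -/
noncomputable def auxF {k : Type*} [Field k] (P : Fin 4 → (Fin 4 → k)) (u v : Fin 4 → k) :
    MvPolynomial (Fin 4) k →ₗ[k] (Fin 4 → k) × (k × k × k) :=
  (LinearMap.pi fun i => (aeval (P i) : MvPolynomial (Fin 4) k →ₐ[k] k).toLinearMap).prod
    ((aeval u : MvPolynomial (Fin 4) k →ₐ[k] k).toLinearMap.prod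
      ((aeval v : MvPolynomial (Fin 4) k →ₐ[k] k).toLinearMap.prod
        ((aeval (u + v) : MvPolynomial (Fin 4) k →ₐ[k] k).toLinearMap
          - (aeval u : MvPolynomial (Fin 4) k →ₐ[k] k).toLinearMap
          - (aeval v : MvPolynomial (Fin 4) k →ₐ[k] k).toLinearMap)))

lemma auxF_apply {k : Type*} [Field k] (P : Fin 4 → (Fin 4 → k)) (u v : Fin 4 → k)
    (q : MvPolynomial (Fin 4) k) :
    auxF P u v q = (fun i => aeval (P i) q, aeval u q, aeval v q,
      aeval (u + v) q - aeval u q - aeval v q) := rfl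

lemma aux_surj {k : Type*} [Field k]
    (P : Fin 4 → (Fin 4 → k)) (hP : LinearIndependent k P)
    (W : Submodule k (Fin 4 → k)) (hPW : ∀ i, P i ∉ W)
    (u v : Fin 4 → k) (hu : u ∈ W) (hv : v ∈ W)
    (huv : ∀ s t : k, s • u + t • v = 0 → s = 0 ∧ t = 0) :
    LinearMap.range ((auxF P u v).domRestrict (homogeneousSubmodule (Fin 4) k 2)) = ⊤ := by
  by_contra hne
  obtain ⟨f, hf0, hf⟩ := Submodule.exists_le_ker_of_lt_top _ (lt_top_iff_ne_top.mpr hne)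
  have hfq : ∀ q ∈ homogeneousSubmodule (Fin 4) k 2, f (auxF P u v q) = 0 := by
    intro q hq
    exact hf ⟨⟨q, hq⟩, rfl⟩
  set b : Module.Basis (Fin 4) k (Fin 4 → k) :=
    basisOfLinearIndependentOfCardEqFinrank hP (by simp) with hb
  have hbP : ∀ i, b i = P i := by intro i; simp [hb]
  let l : Fin 4 → (Fin 4 → k) →ₗ[k] k := fun i => b.coord i
  have hlP : ∀ i j, l i (P j) = if j = i then 1 else 0 := by
    intro i j
    rw [← hbP]
    simp [l, Finsupp.single_apply]
  have hl0 : ∀ w, (∀ i, l i w = 0) → w = 0 := by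
    intro w hw
    exact b.forall_coord_eq_zero_iff.mp hw
  let y : Fin 4 → MvPolynomial (Fin 4) k := fun i => ∑ j, C (l i (Pi.single j 1)) * X j
  have hy : ∀ i w, aeval w (y i) = l i w := by
    intro i w
    have : w = ∑ j, w j • (Pi.single j 1 : Fin 4 → k) := pi_eq_sum_univ' w
    conv_rhs => rw [this]
    simp only [y, map_sum, map_mul, aeval_C, aeval_X, map_smul, smul_eq_mul, Algebra.algebraMap_self,
      RingHom.id_apply]
    exact Finset.sum_congr rfl fun j _ => mul_comm _ _
  have hyh : ∀ i, (y i).IsHomogeneous 1 := by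
    intro i
    refine IsHomogeneous.sum _ _ _ fun j _ => ?_
    simpa using (isHomogeneous_C _ _).mul (isHomogeneous_X k j)
  have hyy : ∀ i j, y i * y j ∈ homogeneousSubmodule (Fin 4) k 2 := by
    intro i j
    exact (hyh i).mul (hyh j)
  set α := f (0, 1, 0, 0) with hα
  set β := f (0, 0, 1, 0) with hβ
  set γ := f (0, 0, 0, 1) with hγ
  have hfx : ∀ c x1 x2 x3, f (c, x1, x2, x3) =
      (∑ i, c i * f (Pi.single i 1, 0, 0, 0)) + x1 * α + x2 * β + x3 * γ := by
    intro c x1 x2 x3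
    have h1 : ((c, x1, x2, x3) : (Fin 4 → k) × (k × k × k)) =
        (∑ i, c i • ((Pi.single i 1, 0, 0, 0) : (Fin 4 → k) × (k × k × k)))
        + x1 • (0, 1, 0, 0) + x2 • (0, 0, 1, 0) + x3 • (0, 0, 0, 1) := by
      have h2 : (∑ i, c i • ((Pi.single i 1, 0, 0, 0) : (Fin 4 → k) × (k × k × k)))
          = (c, 0, 0, 0) := by
        have h3 : ∀ i, c i • ((Pi.single i 1, 0, 0, 0) : (Fin 4 → k) × (k × k × k)) =
          LinearMap.inl k (Fin 4 → k) (k × k × k) (c i • Pi.single i 1) := by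
          intro i; ext <;> simp
        simp_rw [h3]
        rw [← map_sum, ← pi_eq_sum_univ' c]
        rfl
      rw [h2]
      simp
    rw [h1]
    simp only [map_add, map_sum, map_smul, smul_eq_mul, hα, hβ, hγ]
  have key : ∀ i j, (∑ m, (l i (P m) * l j (P m)) * f (Pi.single m 1, 0, 0, 0))
      + l i u * l j u * α + l i v * l j v * β + (l i u * l j v + l i v * l j u) * γ = 0 := by
    intro i j
    have h := hfq _ (hyy i j)
    rw [auxF_apply, hfx] at h
    simp only [map_mul, hy, map_add] at h
    linear_combination h
  have hB : ∀ i, α * l i u + γ * l i v = 0 ∧ γ * l i u + β * l i v = 0 := by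
    intro i
    set w := (α * l i u + γ * l i v) • u + (γ * l i u + β * l i v) • v with hw
    have hwW : w ∈ W := W.add_mem (W.smul_mem _ hu) (W.smul_mem _ hv)
    have hlw : ∀ j, j ≠ i → l j w = 0 := by
      intro j hj
      have h := key i j
      have h0 : (∑ m, (l i (P m) * l j (P m)) * f (Pi.single m 1, 0, 0, 0)) = 0 := by
        refine Finset.sum_eq_zero fun m _ => ?_
        rw [hlP, hlP]
        by_cases hm : m = i
        · subst hm; simp [Ne.symm hj]
        · simp [hm]
      rw [h0] at h
      simp only [hw, map_add, map_smul, smul_eq_mul]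
      linear_combination h
    have hwP : w = l i w • P i := by
      rw [← sub_eq_zero]
      refine hl0 _ fun j => ?_
      rw [map_sub, map_smul, hlP, smul_eq_mul]
      by_cases hj : j = i
      · subst hj; simp
      · simp [hlw j hj, Ne.symm hj]
    have hz : l i w = 0 := by
      by_contra hne'
      apply hPW i
      rw [hwP] at hwW
      exact (W.smul_mem_iff hne').mp hwW
    rw [hz, zero_smul] at hwP
    exact huv _ _ hwP
  have h1 := huv α γ (hl0 _ fun i => by simpa using (hB i).1)
  have h2 := huv γ β (hl0 _ fun i => by simpa using (hB i).2)
  have hc : ∀ i, f (Pi.single i 1, 0, 0, 0) = 0 := by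
    intro i
    have h := key i i
    simpa [hlP, h1.1, h1.2, h2.2] using h
  apply hf0
  apply LinearMap.ext
  rintro ⟨c, x1, x2, x3⟩
  rw [hfx]
  simp [hc, h1.1, h1.2, h2.2]

/-- Let `P₀, P₁, P₂, P₃` be four points of `ℙ³` spanning `ℙ³` (given by linearly
independent coordinate vectors) and let `L ⊂ ℙ³` be a line (given by a `2`-dimensional
subspace `W ⊆ k⁴`) containing none of the `Pᵢ`. Then the space of quadratic forms
vanishing identically on `L` and at each `Pᵢ` has dimension exactly `3`. -/
theorem quadrics_through_line_and_four_points {k : Type*} [Field k] [Infinite k]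
    (P : Fin 4 → (Fin 4 → k)) (hP : LinearIndependent k P)
    (W : Submodule k (Fin 4 → k)) (hW : Module.finrank k W = 2)
    (hPW : ∀ i, P i ∉ W) :
    Module.finrank k
      ↥(homogeneousSubmodule (Fin 4) k 2 ⊓
        (⨅ w ∈ (W : Set (Fin 4 → k)), LinearMap.ker (aeval w : MvPolynomial (Fin 4) k →ₐ[k] k).toLinearMap) ⊓
        (⨅ i : Fin 4, LinearMap.ker (aeval (P i) : MvPolynomial (Fin 4) k →ₐ[k] k).toLinearMap)) = 3 := by
  let bW := Module.finBasisOfFinrankEq k W hW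
  set u : Fin 4 → k := (bW 0 : Fin 4 → k) with hu
  set v : Fin 4 → k := (bW 1 : Fin 4 → k) with hv
  have huv : ∀ s t : k, s • u + t • v = 0 → s = 0 ∧ t = 0 := by
    intro s t h
    have h' : s • bW 0 + t • bW 1 = 0 := Subtype.ext h
    have hl := bW.linearIndependent
    rw [Fintype.linearIndependent_iff] at hl
    have := hl ![s, t] (by simpa [Fin.sum_univ_two] using h')
    exact ⟨this 0, this 1⟩
  have hspan : ∀ w ∈ W, ∃ s t : k, w = s • u + t • v := by
    intro w hw
    have := bW.sum_repr ⟨w, hw⟩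
    rw [Fin.sum_univ_two] at this
    exact ⟨_, _, (congrArg Subtype.val this).symm⟩
  set G := (auxF P u v).domRestrict (homogeneousSubmodule (Fin 4) k 2) with hG
  have hr : LinearMap.range G = ⊤ :=
    aux_surj P hP W hPW u v (bW 0).2 (bW 1).2 huv
  have hfin : Module.Finite k (homogeneousSubmodule (Fin 4) k 2) :=
    Module.Finite.iff_fg.mpr (homogeneousSubmodule_fg _ _ 2)
  have hrn := LinearMap.finrank_range_add_finrank_ker G
  rw [hr, finrank_top, aux_finrank_quadrics] at hrn
  simp only [Module.finrank_prod, Module.finrank_fin_fun, Module.finrank_self] at hrn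
  have hS : homogeneousSubmodule (Fin 4) k 2 ⊓
        (⨅ w ∈ (W : Set (Fin 4 → k)), LinearMap.ker (aeval w : MvPolynomial (Fin 4) k →ₐ[k] k).toLinearMap) ⊓
        (⨅ i : Fin 4, LinearMap.ker (aeval (P i) : MvPolynomial (Fin 4) k →ₐ[k] k).toLinearMap)
      = (LinearMap.ker G).map (homogeneousSubmodule (Fin 4) k 2).subtype := by
    ext q
    simp only [Submodule.mem_inf, Submodule.mem_iInf, LinearMap.mem_ker, Submodule.mem_map,
      AlgHom.toLinearMap_apply, SetLike.mem_coe]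
    constructor
    · rintro ⟨⟨hq, h1⟩, h2⟩
      refine ⟨⟨q, hq⟩, ?_, rfl⟩
      change auxF P u v q = 0
      rw [auxF_apply, h1 u (bW 0).2, h1 v (bW 1).2, h1 (u + v) (W.add_mem (bW 0).2 (bW 1).2)]
      simp only [h2, sub_zero]
      rfl
    · rintro ⟨⟨q', hq⟩, h, rfl⟩
      change auxF P u v q' = 0 at h
      rw [auxF_apply] at h
      simp only [Prod.mk_eq_zero] at h
      obtain ⟨h1, h2, h3, h4⟩ := h
      refine ⟨⟨hq, ?_⟩, fun i => congrFun h1 i⟩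
      intro w hw
      obtain ⟨s, t, rfl⟩ := hspan w hw
      change aeval (s • u + t • v) q' = 0
      rw [aux_quadratic q' hq, h4, h2, h3]
      simp
  rw [hS, Submodule.finrank_map_subtype_eq]
  omega
end
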